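/- arXiv:2011.08540 — 8 statements merged into one kernel-verified Lean document; each statement's English description precedes it below -/
import Mathlib

section
/- Let S and T be proper numerical sets. Then the set of gaps of the overlap sum satisfies G(S ⊞_O T) = (G(S) \ {F(S)}) ∪ {F(S)−1+b : b ∈ G(T)}, and the Frobenius number satisfies F(S ⊞_O T) = F(S)+F(T)−1. -/
/-- A numerical set: a subset of ℕ containing 0 with finite complement. -/
def IsNumericalSet (S : Set ℕ) : Prop := 0 ∈ S ∧ Sᶜ.Finite

/-- A numerical semigroup: a numerical set closed under addition. -/
def IsNumericalSemigroup (S : Set ℕ) : Prop :=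
  IsNumericalSet S ∧ ∀ x ∈ S, ∀ y ∈ S, x + y ∈ S

/-- The Frobenius number: the largest gap. -/
noncomputable def frob (S : Set ℕ) : ℕ := sSup Sᶜ

/-- The condNum: F(S) + 1. -/
noncomputable def condNum (S : Set ℕ) : ℕ := frob S + 1

/-- The genus: the number of gaps. -/
noncomputable def genus (S : Set ℕ) : ℕ := Sᶜ.ncard

/-- The dual of a numerical set: `S* = {x ∈ ℕ : F(S) − x ∉ S}`, difference taken in ℤ. -/
noncomputable def dual (S : Set ℕ) : Set ℕ :=
  {x : ℕ | ((frob S : ℤ) - (x : ℤ)) ∉ ((fun n : ℕ => (n : ℤ)) '' S)}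

/-- Discrete sum: `{s ∈ S : s < C(S)} ∪ {C(S) + 1 + t : t ∈ T}`. -/
noncomputable def dsum (S T : Set ℕ) : Set ℕ :=
  {s ∈ S | s < condNum S} ∪ (fun t => condNum S + 1 + t) '' T

/-- End-to-end sum: `{s ∈ S : s < C(S)} ∪ {C(S) + t : t ∈ T}`. -/
noncomputable def esum (S T : Set ℕ) : Set ℕ :=
  {s ∈ S | s < condNum S} ∪ (fun t => condNum S + t) '' T

/-- Conjoint sum: `{s ∈ S : s < C(S)} ∪ {C(S) − 1 + t : t ∈ T, t > 0}`. -/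
noncomputable def csum (S T : Set ℕ) : Set ℕ :=
  {s ∈ S | s < condNum S} ∪ {x | ∃ t ∈ T, 0 < t ∧ x = condNum S - 1 + t}

/-- Overlap sum: `{s ∈ S : s < C(S)} ∪ {C(S) − 2 + t : t ∈ T, t > 0}`. -/
noncomputable def osum (S T : Set ℕ) : Set ℕ :=
  {s ∈ S | s < condNum S} ∪ {x | ∃ t ∈ T, 0 < t ∧ x = condNum S - 2 + t}

/-- Symmetric numerical semigroup: F(S) odd and every integer not in S is F(S) minus an element of S. -/
def IsSymmetric (S : Set ℕ) : Prop :=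
  Odd (frob S) ∧ ∀ x : ℤ, x ∉ ((fun n : ℕ => (n : ℤ)) '' S) →
    (frob S : ℤ) - x ∈ ((fun n : ℕ => (n : ℤ)) '' S)

/-- Pseudo-symmetric numerical semigroup: F(S) even and every integer not in S is F(S)/2
or F(S) minus an element of S. -/
def IsPseudoSymmetric (S : Set ℕ) : Prop :=
  Even (frob S) ∧ ∀ x : ℤ, x ∉ ((fun n : ℕ => (n : ℤ)) '' S) →
    x = (frob S : ℤ) / 2 ∨ (frob S : ℤ) - x ∈ ((fun n : ℕ => (n : ℤ)) '' S)

theorem IsNumericalSet.isGreatest_frob {S : Set ℕ} (hS : IsNumericalSet S)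
    (hSp : S ≠ Set.univ) : IsGreatest Sᶜ (frob S) :=
  ⟨Nat.sSup_mem (Set.nonempty_compl.mpr hSp) hS.2.bddAbove,
    fun _ hx => le_csSup hS.2.bddAbove hx⟩

theorem IsNumericalSet.pos_of_notMem {S : Set ℕ} (hS : IsNumericalSet S) {x : ℕ}
    (hx : x ∉ S) : 0 < x :=
  Nat.pos_of_ne_zero fun h => hx (h ▸ hS.1)

theorem compl_osum {S T : Set ℕ} (hS : IsNumericalSet S) (hSp : S ≠ Set.univ)
    (hT : IsNumericalSet T) :
    (osum S T)ᶜ = (Sᶜ \ {frob S}) ∪ (fun b => frob S - 1 + b) '' Tᶜ := by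
  obtain ⟨hF, hmax⟩ := hS.isGreatest_frob hSp
  have hFpos := hS.pos_of_notMem hF
  ext x
  simp only [osum, condNum, Set.mem_compl_iff, Set.mem_union, Set.mem_ofPred_eq, Set.mem_sdiff,
    Set.mem_singleton_iff, Set.mem_image, not_or, not_and, not_exists]
  constructor
  · rintro ⟨hxS, hxT⟩
    rcases lt_or_ge x (frob S) with hlt | hge
    · exact Or.inl ⟨fun h => hxS h (by omega), hlt.ne⟩
    · exact Or.inr ⟨x - (frob S - 1), fun h => hxT _ h (by omega) (by omega), by omega⟩
  · rintro (⟨hxS, hne⟩ | ⟨b, hb, rfl⟩)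
    · have hle : x ≤ frob S := hmax hxS
      exact ⟨fun h => absurd h hxS, fun t _ _ _ => by omega⟩
    · have hbpos := hT.pos_of_notMem hb
      refine ⟨fun h hlt => hF ?_, fun t ht _ heq => hb ?_⟩
      · rwa [show frob S - 1 + b = frob S by omega] at h
      · rwa [show b = t by omega]

theorem overlap_sum_gaps_and_frobenius (S T : Set ℕ)
    (hS : IsNumericalSet S) (hSp : S ≠ Set.univ)
    (hT : IsNumericalSet T) (hTp : T ≠ Set.univ) :
    (osum S T)ᶜ = (Sᶜ \ {frob S}) ∪ (fun b => frob S - 1 + b) '' Tᶜ ∧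
    frob (osum S T) = frob S + frob T - 1 := by
  refine ⟨compl_osum hS hSp hT, ?_⟩
  obtain ⟨hFS, hmaxS⟩ := hS.isGreatest_frob hSp
  obtain ⟨hFT, hmaxT⟩ := hT.isGreatest_frob hTp
  have hSpos := hS.pos_of_notMem hFS
  have hTpos := hT.pos_of_notMem hFT
  refine IsGreatest.csSup_eq (s := (osum S T)ᶜ) ?_
  rw [compl_osum hS hSp hT]
  refine ⟨Or.inr ⟨frob T, hFT, by dsimp only; omega⟩, ?_⟩
  rintro x (⟨hx, -⟩ | ⟨b, hb, rfl⟩)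
  · have := hmaxS hx
    omega
  · have := hmaxT hb
    dsimp only
    omega
end

section
/- Let S be a proper numerical semigroup such that C(S) = a + b for some nonzero elements a, b ∈ S (i.e., the conductor is not a minimal generator of S). Then neither S ⊞_C S nor S ⊞_D S is a numerical semigroup (each is a numerical set that is not closed under addition). -/
/-- A proper numerical semigroup does not contain 1. -/
theorem IsNumericalSemigroup.one_notMem {S : Set ℕ} (hS : IsNumericalSemigroup S)
    (hSp : S ≠ Set.univ) : 1 ∉ S := by
  intro h1
  refine hSp (Set.eq_univ_of_forall fun n => ?_)
  induction n with
  | zero => exact hS.1.1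
  | succ k ih => exact hS.2 k ih 1 h1

theorem csum_dsum_not_semigroup_of_conductor_not_minimal (S : Set ℕ)
    (hS : IsNumericalSemigroup S) (hSp : S ≠ Set.univ)
    (h : ∃ a ∈ S, ∃ b ∈ S, a ≠ 0 ∧ b ≠ 0 ∧ a + b = condNum S) :
    (¬ ∀ x ∈ csum S S, ∀ y ∈ csum S S, x + y ∈ csum S S) ∧
    (¬ ∀ x ∈ dsum S S, ∀ y ∈ dsum S S, x + y ∈ dsum S S) := by
  obtain ⟨a, ha, b, hb, ha0, hb0, hab⟩ := h
  have haC : a < condNum S := by omega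
  have hbC : b < condNum S := by omega
  constructor
  · intro hadd
    rcases hadd a (Or.inl ⟨ha, haC⟩) b (Or.inl ⟨hb, hbC⟩) with ⟨-, hlt⟩ | ⟨t, ht, -, heq⟩
    · omega
    · obtain rfl : t = 1 := by omega
      exact hS.one_notMem hSp ht
  · intro hadd
    rcases hadd a (Or.inl ⟨ha, haC⟩) b (Or.inl ⟨hb, hbC⟩) with ⟨-, hlt⟩ | ⟨t, -, heq⟩
    · omega
    · dsimp only at heq
      omega
end

section
/- For every symmetric proper numerical semigroup S, there exists a proper numerical semigroup T such that S = T ⊞_E T* or S = T ⊞_O T*. -/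
theorem mem_dual_iff {S : Set ℕ} {x : ℕ} : x ∈ dual S ↔ ∀ n ∈ S, n + x ≠ frob S := by
  simp only [dual, Set.mem_ofPred_eq, Set.mem_image, not_exists, not_and]
  exact forall₂_congr fun n _ => by omega

theorem frob_notMem {S : Set ℕ} (hS : IsNumericalSet S) (hSp : S ≠ Set.univ) : frob S ∉ S :=
  Nat.sSup_mem (Set.nonempty_compl.2 hSp) hS.2.bddAbove

/-- A symmetric numerical semigroup is self-dual. -/
theorem IsSymmetric.dual_eq {S : Set ℕ} (hsym : IsSymmetric S) (hS : IsNumericalSemigroup S)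
    (hSp : S ≠ Set.univ) : dual S = S := by
  ext x
  rw [mem_dual_iff]
  constructor
  · intro h
    by_contra hx
    obtain ⟨n, hn, hnx⟩ := hsym.2 x (by simpa using hx)
    exact h n hn (by dsimp only at hnx; omega)
  · intro hx n hn h
    exact frob_notMem hS.1 hSp (h ▸ hS.2 n hn x hx)

theorem IsNumericalSemigroup.union_Ioi {S : Set ℕ} (hS : IsNumericalSemigroup S) (m : ℕ) :
    IsNumericalSemigroup (S ∪ Set.Ioi m) := by
  refine ⟨⟨Or.inl hS.1.1, hS.1.2.subset (Set.compl_subset_compl.2 Set.subset_union_left)⟩, ?_⟩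
  rintro x (hx | hx) y (hy | hy)
  · exact Or.inl (hS.2 x hx y hy)
  all_goals
    right
    simp only [Set.mem_Ioi] at *
    omega

theorem frob_union_Ioi {S : Set ℕ} {m : ℕ} (hm : m ∉ S) : frob (S ∪ Set.Ioi m) = m := by
  refine IsGreatest.csSup_eq ⟨by simpa using hm, fun x hx => ?_⟩
  simp only [Set.mem_compl_iff, Set.mem_union, Set.mem_Ioi, not_or, not_lt] at hx
  exact hx.2

theorem union_Ioi_ne_univ {S : Set ℕ} {m : ℕ} (hm : m ∉ S) : S ∪ Set.Ioi m ≠ Set.univ :=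
  (Set.ne_univ_iff_exists_notMem _).2 ⟨m, by simpa using hm⟩

theorem mem_dual_union_Ioi {S : Set ℕ} {m x : ℕ} (hm : m ∉ S) :
    x ∈ dual (S ∪ Set.Ioi m) ↔ ∀ n ∈ S, n + x ≠ m := by
  rw [mem_dual_iff, frob_union_Ioi hm]
  refine ⟨fun h n hn => h n (Or.inl hn), ?_⟩
  rintro h n (hn | hn)
  · exact h n hn
  · have : m < n := hn
    omega

theorem symmetric_decomposition_exists (S : Set ℕ)
    (hS : IsNumericalSemigroup S) (hSp : S ≠ Set.univ)
    (hsym : IsSymmetric S) :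
    ∃ T : Set ℕ, IsNumericalSemigroup T ∧ T ≠ Set.univ ∧
      (S = esum T (dual T) ∨ S = osum T (dual T)) := by
  obtain ⟨k, hk⟩ := hsym.1
  have mem_iff (x : ℕ) : x ∈ S ↔ ∀ n ∈ S, n + x ≠ 2 * k + 1 := by
    rw [← hk, ← mem_dual_iff, hsym.dual_eq hS hSp]
  by_cases hkS : k ∈ S
  · have hm : k + 1 ∉ S := fun h => (mem_iff _).1 h k hkS (by omega)
    refine ⟨S ∪ Set.Ioi (k + 1), hS.union_Ioi _, union_Ioi_ne_univ hm, Or.inr ?_⟩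
    ext x
    simp only [osum, condNum, frob_union_Ioi hm, mem_dual_union_Ioi hm, Set.mem_union,
      Set.mem_ofPred_eq, Set.mem_Ioi]
    constructor
    · intro hx
      by_cases hxk : x < k + 1 + 1
      · exact Or.inl ⟨Or.inl hx, hxk⟩
      · refine Or.inr ⟨x - k, fun n hn h => ?_, by omega, by omega⟩
        exact (mem_iff x).1 hx n hn (by omega)
    · rintro (⟨hx | hx, hlt⟩ | ⟨t, ht, -, rfl⟩)
      · exact hx
      · omega
      · exact (mem_iff _).2 fun n hn h => ht n hn (by omega)
  · refine ⟨S ∪ Set.Ioi k, hS.union_Ioi _, union_Ioi_ne_univ hkS, Or.inl ?_⟩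
    ext x
    simp only [esum, condNum, frob_union_Ioi hkS, mem_dual_union_Ioi hkS, Set.mem_union,
      Set.mem_ofPred_eq, Set.mem_Ioi, Set.mem_image]
    constructor
    · intro hx
      by_cases hxk : x < k + 1
      · exact Or.inl ⟨Or.inl hx, hxk⟩
      · refine Or.inr ⟨x - (k + 1), fun n hn h => ?_, by omega⟩
        exact (mem_iff x).1 hx n hn (by omega)
    · rintro (⟨hx | hx, hlt⟩ | ⟨t, ht, rfl⟩)
      · exact hx
      · omega
      · exact (mem_iff _).2 fun n hn h => ht n hn (by omega)
end

section
/- For every pseudo-symmetric proper numerical semigroup S not equal to {0} ∪ {n ∈ ℕ : n ≥ 3}, there exists a non-symmetric proper numerical semigroup T such that S = T ⊞_C T* or S = T ⊞_D T*. -/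
theorem natCast_mem_image_iff (S : Set ℕ) (n : ℕ) :
    (n : ℤ) ∈ ((fun n : ℕ => (n : ℤ)) '' S) ↔ n ∈ S := by
  simp

theorem frob_eq_of_isGreatest {S : Set ℕ} {f : ℕ} (hf : f ∉ S) (h : ∀ x, f < x → x ∈ S) :
    frob S = f :=
  IsGreatest.csSup_eq ⟨hf, fun x hx => not_lt.1 fun hlt => hx (h x hlt)⟩

theorem frob_notMem_s10 {S : Set ℕ} (hfin : Sᶜ.Finite) (hne : S ≠ Set.univ) : frob S ∉ S :=
  Nat.sSup_mem (Set.nonempty_compl.2 hne) hfin.bddAbove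

theorem mem_of_frob_lt {S : Set ℕ} (hfin : Sᶜ.Finite) {x : ℕ} (hx : frob S < x) : x ∈ S := by
  by_contra h
  exact absurd (le_csSup hfin.bddAbove h) (not_le.2 hx)

/-- The set agreeing with `S` below `m`, with largest gap `m`. -/
def truncation (S : Set ℕ) (m : ℕ) : Set ℕ := {x | (x < m ∧ x ∈ S) ∨ m < x}

theorem notMem_truncation (S : Set ℕ) (m : ℕ) : m ∉ truncation S m := by
  simp [truncation]

theorem mem_truncation_of_lt {S : Set ℕ} {m x : ℕ} (h : x < m) : x ∈ truncation S m ↔ x ∈ S := by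
  simp [truncation, h, h.le]

theorem mem_truncation_of_gt {S : Set ℕ} {m x : ℕ} (h : m < x) : x ∈ truncation S m :=
  Or.inr h

theorem frob_truncation (S : Set ℕ) (m : ℕ) : frob (truncation S m) = m :=
  frob_eq_of_isGreatest (notMem_truncation S m) fun _ => mem_truncation_of_gt

theorem isNumericalSemigroup_truncation {S : Set ℕ} {m : ℕ} (hS : IsNumericalSemigroup S)
    (hm : m ∉ S) : IsNumericalSemigroup (truncation S m) := by
  obtain ⟨⟨h0, -⟩, hadd⟩ := hS
  refine ⟨⟨?_, (Set.finite_Iic m).subset fun x hx =>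
    not_lt.1 fun h => hx (mem_truncation_of_gt h)⟩, ?_⟩
  · rcases Nat.eq_zero_or_pos m with rfl | h
    · exact absurd h0 hm
    · exact Or.inl ⟨h, h0⟩
  · rintro x (⟨-, hxS⟩ | hx) y (⟨-, hyS⟩ | hy)
    · have hxy := hadd x hxS y hyS
      rcases lt_trichotomy (x + y) m with h | h | h
      · exact Or.inl ⟨h, hxy⟩
      · exact absurd (h ▸ hxy) hm
      · exact Or.inr h
    all_goals exact Or.inr (by omega)

/-- A pseudo-symmetric semigroup contains exactly one of `x` and `F(S) - x`, for `x ≠ F(S)/2`. -/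
theorem IsPseudoSymmetric.mem_iff {S : Set ℕ} {m x y : ℕ} (hS : IsNumericalSemigroup S)
    (hps : IsPseudoSymmetric S) (hF : frob S = 2 * m) (hFS : 2 * m ∉ S) (hxy : x + y = 2 * m)
    (hx : x ≠ m) : x ∈ S ↔ y ∉ S := by
  refine ⟨fun h h' => hFS (hxy ▸ hS.2 x h y h'), fun h => ?_⟩
  rcases hps.2 y (by rwa [natCast_mem_image_iff]) with h | h
  · omega
  · rwa [show (frob S : ℤ) - y = (x : ℤ) by omega, natCast_mem_image_iff] at h

theorem mem_dual_iff_of_add_eq_frob {T : Set ℕ} {x y : ℕ} (h : x + y = frob T) : x ∈ dual T ↔ y ∉ T := by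
  rw [dual, Set.mem_ofPred_eq, show (frob T : ℤ) - x = (y : ℤ) by omega, natCast_mem_image_iff]

theorem mem_dual_of_frob_lt {T : Set ℕ} {x : ℕ} (h : frob T < x) : x ∈ dual T := by
  rintro ⟨y, -, hy⟩
  simp only at hy
  omega

/-- A pseudo-symmetric semigroup is the conjoint sum of its truncation at `F(S)/2` and the dual. -/
theorem IsPseudoSymmetric.eq_csum_truncation {S : Set ℕ} {m : ℕ} (hS : IsNumericalSemigroup S)
    (hps : IsPseudoSymmetric S) (hF : frob S = 2 * m) (hFS : 2 * m ∉ S) (hm : m ∉ S) :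
    S = csum (truncation S m) (dual (truncation S m)) := by
  have hT := frob_truncation S m
  ext x
  simp only [csum, condNum, hT, Set.mem_union, Set.mem_ofPred_eq, Nat.add_sub_cancel]
  rcases lt_trichotomy x m with h | rfl | h
  · rw [mem_truncation_of_lt h]
    exact ⟨fun hx => Or.inl ⟨hx, by omega⟩, fun hx => hx.elim And.left fun ⟨t, _, _, _⟩ => by omega⟩
  · refine iff_of_false hm ?_
    rintro (⟨hx, -⟩ | ⟨t, -, ht, hx⟩)
    · exact notMem_truncation S x hx
    · omega
  · obtain ⟨t, rfl⟩ := Nat.exists_eq_add_of_lt h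
    have key : m + t + 1 ∈ S ↔ t + 1 ∈ dual (truncation S m) := by
      rcases le_or_gt (t + 1) m with htm | htm
      · obtain ⟨y, rfl⟩ := Nat.exists_eq_add_of_le htm
        rw [mem_dual_iff_of_add_eq_frob hT.symm, mem_truncation_of_lt (by omega)]
        exact hps.mem_iff hS hF hFS (by omega) (by omega)
      · exact iff_of_true (mem_of_frob_lt hS.1.2 (by omega)) (mem_dual_of_frob_lt (by omega))
    rw [key]
    refine ⟨fun ht => Or.inr ⟨t + 1, ht, by omega, by omega⟩, ?_⟩
    rintro (⟨-, hlt⟩ | ⟨s, hs, -, hst⟩)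
    · omega
    · rwa [show t + 1 = s by omega]

theorem not_isSymmetric_truncation {S : Set ℕ} {m : ℕ} (hS : IsNumericalSemigroup S)
    (hFS : 2 * m ∉ S) (hm : 1 < m) : ¬ IsSymmetric (truncation S m) := by
  rintro ⟨-, hsym⟩
  have reflect : ∀ x y, 0 < x → 0 < y → x + y = m → x ∉ S → y ∈ S := by
    intro x y hx hy hxy hxS
    have h := hsym x (by rwa [natCast_mem_image_iff, mem_truncation_of_lt (by omega)])
    rwa [frob_truncation, show (m : ℤ) - x = (y : ℤ) by omega, natCast_mem_image_iff,
      mem_truncation_of_lt (by omega)] at h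
  have h1 : 1 ∉ S := fun h => hFS <| by
    have hall : ∀ n, n ∈ S := fun n => by
      induction n with
      | zero => exact hS.1.1
      | succ k ih => exact hS.2 k ih 1 h
    exact hall _
  have hpred : m - 1 ∈ S := reflect 1 (m - 1) one_pos (by omega) (by omega) h1
  classical
  have hex : ∃ a, 0 < a ∧ a ∈ S := ⟨m - 1, by omega, hpred⟩
  obtain ⟨hpos, ha⟩ := Nat.find_spec hex
  have hle : Nat.find hex ≤ m - 1 := Nat.find_min' hex ⟨by omega, hpred⟩
  have hmin : ∀ b, b < Nat.find hex → ¬ (0 < b ∧ b ∈ S) := fun b hb => Nat.find_min hex hb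
  generalize Nat.find hex = a at *
  have ha1 : a ≠ 1 := fun h => h1 (h ▸ ha)
  have hb := reflect (a - 1) (m - (a - 1)) (by omega) (by omega) (by omega)
    fun h => hmin (a - 1) (by omega) ⟨by omega, h⟩
  have hsum := hS.2 _ (hS.2 _ hb _ hpred) _ ha
  exact hFS (by rwa [show m - (a - 1) + (m - 1) + a = 2 * m by omega] at hsum)

theorem pseudosymmetric_decomposition_exists (S : Set ℕ)
    (hS : IsNumericalSemigroup S) (hSp : S ≠ Set.univ)
    (hps : IsPseudoSymmetric S)
    (hS3 : S ≠ {0} ∪ {n : ℕ | 3 ≤ n}) :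
    ∃ T : Set ℕ, IsNumericalSemigroup T ∧ T ≠ Set.univ ∧ ¬ IsSymmetric T ∧
      (S = csum T (dual T) ∨ S = dsum T (dual T)) := by
  obtain ⟨m, hF⟩ := hps.1.exists_two_nsmul
  rw [smul_eq_mul] at hF
  have hFS : 2 * m ∉ S := hF ▸ frob_notMem_s10 hS.1.2 hSp
  have hm : m ∉ S := fun h => hFS (two_mul m ▸ hS.2 m h m h)
  have hm0 : m ≠ 0 := fun h => hm (h ▸ hS.1.1)
  have hm1 : m ≠ 1 := by
    rintro rfl
    refine hS3 (Set.ext fun x => ?_)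
    rcases lt_or_ge x 3 with hx | hx
    · interval_cases x <;> simp_all [hS.1.1]
    · exact iff_of_true (mem_of_frob_lt hS.1.2 (by omega)) (Or.inr hx)
  exact ⟨truncation S m, isNumericalSemigroup_truncation hS hm,
    fun h => notMem_truncation S m (h ▸ Set.mem_univ m),
    not_isSymmetric_truncation hS hFS (by omega),
    Or.inl (hps.eq_csum_truncation hS hF hFS hm)⟩
end

section
/- If S is a symmetric proper numerical semigroup not equal to {0} ∪ {n ∈ ℕ : n ≥ 2}, then the conductor C(S) is not a minimal generator of S; that is, there exist nonzero elements a, b ∈ S with a + b = C(S). -/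
/-- Every natural number exceeding the Frobenius number lies in the numerical set. -/
theorem IsNumericalSet.mem_of_frob_lt {S : Set ℕ} (hS : IsNumericalSet S) {n : ℕ}
    (hn : frob S < n) : n ∈ S := by
  by_contra h
  exact absurd (le_csSup hS.2.bddAbove h) (not_le.mpr hn)

/-- In a symmetric numerical semigroup, every gap `x` is complementary to an element. -/
theorem IsSymmetric.exists_add_eq_frob {S : Set ℕ} (hsym : IsSymmetric S) {x : ℕ}
    (hx : x ∉ S) : ∃ y ∈ S, x + y = frob S := by
  obtain ⟨y, hy, hxy⟩ := hsym.2 x (by simpa using hx)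
  exact ⟨y, hy, by dsimp only at hxy; omega⟩

theorem conductor_not_minimal_generator_of_symmetric (S : Set ℕ)
    (hS : IsNumericalSemigroup S) (hSp : S ≠ Set.univ)
    (hsym : IsSymmetric S)
    (hne : S ≠ {0} ∪ {n : ℕ | 2 ≤ n}) :
    ∃ a ∈ S, ∃ b ∈ S, a ≠ 0 ∧ b ≠ 0 ∧ a + b = condNum S := by
  have h1 : 1 ∉ S := hS.one_notMem hSp
  have hex : ∃ m, m ∈ S ∧ m ≠ 0 :=
    ⟨frob S + 1, hS.1.mem_of_frob_lt (Nat.lt_succ_self _), Nat.succ_ne_zero _⟩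
  -- The multiplicity `m` of `S`: its complement to the conductor lies in `S` as `m - 1` is a gap.
  obtain ⟨m, ⟨hm, hm0⟩, hmin⟩ : ∃ m, (m ∈ S ∧ m ≠ 0) ∧ ∀ k ∈ S, k ≠ 0 → m ≤ k := by
    classical
    exact ⟨Nat.find hex, Nat.find_spec hex, fun k hk hk0 => Nat.find_min' hex ⟨hk, hk0⟩⟩
  have hm1 : m ≠ 1 := fun h => h1 (h ▸ hm)
  have hgap : m - 1 ∉ S := fun h => by
    have := hmin _ h (by omega)
    omega
  obtain ⟨b, hb, hmb⟩ := hsym.exists_add_eq_frob hgap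
  refine ⟨m, hm, b, hb, hm0, ?_, by unfold condNum; omega⟩
  rintro rfl
  obtain ⟨c, hc, hcF⟩ := hsym.exists_add_eq_frob h1
  have hc0 : c = 0 := by
    by_contra h
    have := hmin c hc h
    omega
  apply hne
  ext n
  simp only [Set.mem_union, Set.mem_singleton_iff, Set.mem_ofPred_eq]
  constructor
  · intro hn
    have : n ≠ 1 := fun h => h1 (h ▸ hn)
    omega
  · rintro (rfl | hn)
    · exact hS.1.1
    · exact hS.1.mem_of_frob_lt (by omega)
end

section
/- Let S be a proper numerical semigroup. Then S ⊞_D S* is a numerical semigroup if and only if C(S) is a minimal generator of S (i.e., C(S) ≠ a + b for all nonzero a, b ∈ S) and 2·C(S) − a − b ≠ c for all small elements a, b, c of S. -/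
/-- Membership in `S ⊞_D S*`: a small element of `S`, or some `x > C(S)` with `2 C(S) - x ∉ S`. -/
theorem mem_dsum_dual {S : Set ℕ} {x : ℕ} :
    x ∈ dsum S (dual S) ↔
      (x ∈ S ∧ x < condNum S) ∨ (condNum S < x ∧ ∀ s ∈ S, s + x ≠ 2 * condNum S) := by
  simp only [dsum, dual, Set.mem_union, Set.mem_ofPred_eq, Set.mem_image, not_exists, not_and]
  refine or_congr_right ⟨?_, ?_⟩
  · rintro ⟨t, ht, rfl⟩
    refine ⟨by omega, fun s hs h => ht s hs ?_⟩
    simp only [condNum] at h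
    omega
  · rintro ⟨hx, h⟩
    refine ⟨x - (condNum S + 1), fun s hs hst => h s hs ?_, by omega⟩
    simp only [condNum] at hx hst ⊢
    omega

theorem dsum_dual_semigroup_iff (S : Set ℕ)
    (hS : IsNumericalSemigroup S) (hSp : S ≠ Set.univ) :
    IsNumericalSemigroup (dsum S (dual S)) ↔
      ((∀ a ∈ S, ∀ b ∈ S, a ≠ 0 → b ≠ 0 → a + b ≠ condNum S) ∧
       (∀ a ∈ S, ∀ b ∈ S, ∀ c ∈ S, a < condNum S → b < condNum S → c < condNum S →
          2 * (condNum S : ℤ) - (a : ℤ) - (b : ℤ) ≠ (c : ℤ))) := by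
  constructor
  · rintro ⟨-, hadd⟩
    refine ⟨fun a ha b hb ha0 hb0 hab => ?_, fun a ha b hb c hc haC hbC hcC habc => ?_⟩
    · have := hadd a (mem_dsum_dual.2 (.inl ⟨ha, by omega⟩)) b
        (mem_dsum_dual.2 (.inl ⟨hb, by omega⟩))
      rcases mem_dsum_dual.1 this with ⟨-, h⟩ | ⟨h, -⟩ <;> omega
    · have := hadd a (mem_dsum_dual.2 (.inl ⟨ha, haC⟩)) b (mem_dsum_dual.2 (.inl ⟨hb, hbC⟩))
      rcases mem_dsum_dual.1 this with ⟨-, h⟩ | ⟨-, h⟩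
      · omega
      · exact h c hc (by omega)
  · rintro ⟨hgen, hsum⟩
    refine ⟨⟨mem_dsum_dual.2 (.inl ⟨hS.1.1, Nat.succ_pos _⟩), ?_⟩, fun x hx y hy => ?_⟩
    · refine (Set.finite_Iic (2 * condNum S)).subset fun x hx => ?_
      by_contra hlt
      simp only [Set.mem_Iic, not_le] at hlt
      exact hx (mem_dsum_dual.2 (.inr ⟨by omega, fun s _ => by omega⟩))
    · rw [mem_dsum_dual] at hx hy ⊢
      rcases hx with ⟨hxS, hx⟩ | ⟨hx, hx'⟩ <;> rcases hy with ⟨hyS, hy⟩ | ⟨hy, hy'⟩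
      · rcases lt_trichotomy (x + y) (condNum S) with h | h | h
        · exact .inl ⟨hS.2 x hxS y hyS, h⟩
        · exact absurd h (hgen x hxS y hyS (by omega) (by omega))
        · exact .inr ⟨h, fun s hs hsxy =>
            hsum x hxS y hyS s hs hx hy (by omega) (by omega)⟩
      · exact .inr ⟨by omega, fun s hs h => hy' (s + x) (hS.2 s hs x hxS) (by omega)⟩
      · exact .inr ⟨by omega, fun s hs h => hx' (s + y) (hS.2 s hs y hyS) (by omega)⟩
      · exact .inr ⟨by omega, fun s _ => by omega⟩
end

section
/- Let S be a proper numerical semigroup. Then S ⊞_E S* is a numerical semigroup if and only if 2·C(S) − a − b − 1 ≠ c for all small elements a, b, c of S. -/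
/-- Membership in `S ⊞_E S*`: below the conductor it is membership in `S`, and from the conductor
on it is governed by the reflection `x ↦ 2 F(S) + 1 - x`. -/
theorem mem_esum_dual_iff (S : Set ℕ) (x : ℕ) :
    x ∈ esum S (dual S) ↔
      (x ∈ S ∧ x < condNum S) ∨ (condNum S ≤ x ∧ ∀ c ∈ S, c + x ≠ 2 * frob S + 1) := by
  simp only [esum, dual, condNum, Set.mem_union, Set.mem_ofPred_eq, Set.mem_image, not_exists,
    not_and]
  refine or_congr Iff.rfl ⟨?_, ?_⟩
  · rintro ⟨t, ht, rfl⟩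
    exact ⟨by omega, fun c hc h => ht c hc (by omega)⟩
  · rintro ⟨hx, h⟩
    exact ⟨x - (frob S + 1), fun c hc e => h c hc (by omega), by omega⟩

theorem esum_dual_semigroup_iff (S : Set ℕ)
    (hS : IsNumericalSemigroup S) (hSp : S ≠ Set.univ) :
    IsNumericalSemigroup (esum S (dual S)) ↔
      (∀ a ∈ S, ∀ b ∈ S, ∀ c ∈ S, a < condNum S → b < condNum S → c < condNum S →
        2 * (condNum S : ℤ) - (a : ℤ) - (b : ℤ) - 1 ≠ (c : ℤ)) := by
  have hC : condNum S = frob S + 1 := rfl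
  constructor
  · rintro ⟨-, hadd⟩ a ha b hb c hc haC hbC hcC h
    have hab := hadd a ((mem_esum_dual_iff S a).2 (.inl ⟨ha, haC⟩))
      b ((mem_esum_dual_iff S b).2 (.inl ⟨hb, hbC⟩))
    rcases (mem_esum_dual_iff S (a + b)).1 hab with ⟨-, h'⟩ | ⟨-, h'⟩
    · omega
    · exact h' c hc (by omega)
  · intro h
    refine ⟨⟨(mem_esum_dual_iff S 0).2 (.inl ⟨hS.1.1, by omega⟩),
      (Set.finite_Iic (2 * frob S + 1)).subset fun x hx => ?_⟩, fun x hx y hy => ?_⟩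
    · by_contra hlt
      rw [Set.mem_Iic] at hlt
      exact hx ((mem_esum_dual_iff S x).2 (.inr ⟨by omega, fun c _ => by omega⟩))
    · rw [mem_esum_dual_iff] at hx hy ⊢
      rcases hx with ⟨hx, hxC⟩ | ⟨hxC, hx⟩ <;> rcases hy with ⟨hy, hyC⟩ | ⟨hyC, hy⟩
      · by_cases hxy : x + y < condNum S
        · exact .inl ⟨hS.2 x hx y hy, hxy⟩
        · exact .inr ⟨by omega, fun c hc e =>
            h x hx y hy c hc hxC hyC (by omega) (by omega)⟩
      · exact .inr ⟨by omega, fun c hc e => hy (c + x) (hS.2 c hc x hx) (by omega)⟩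
      · exact .inr ⟨by omega, fun c hc e => hx (c + y) (hS.2 c hc y hy) (by omega)⟩
      · exact .inr ⟨by omega, fun c _ => by omega⟩
end

section
/- Let S be a proper numerical semigroup. Then S ⊞_O S* is a numerical semigroup if and only if 2·F(S) − a − b − 1 ≠ c for all small elements a, b, c of S. -/
theorem frob_pos {S : Set ℕ} (hS : IsNumericalSet S) (hSp : S ≠ Set.univ) : 0 < frob S := by
  refine Nat.pos_of_ne_zero fun h => frob_notMem hS hSp ?_
  rw [h]
  exact hS.1

theorem mem_dual {S : Set ℕ} {x : ℕ} : x ∈ dual S ↔ ∀ c ∈ S, x + c ≠ frob S := by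
  simp only [dual, Set.mem_ofPred_eq, Set.mem_image, not_exists, not_and]
  exact forall₂_congr fun c _ => by omega

theorem mem_osum_dual {S : Set ℕ} (hS : IsNumericalSet S) (hSp : S ≠ Set.univ) {x : ℕ} :
    x ∈ osum S (dual S) ↔
      (x ∈ S ∧ x < frob S) ∨ (frob S ≤ x ∧ ∀ c ∈ S, x + c + 1 ≠ 2 * frob S) := by
  have hF := frob_notMem hS hSp
  have hpos := frob_pos hS hSp
  simp only [osum, condNum, Set.mem_union, Set.mem_ofPred_eq, mem_dual]
  refine or_congr (and_congr_right fun hx => ?_) ⟨?_, ?_⟩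
  · have : x ≠ frob S := fun h => hF (h ▸ hx)
    omega
  · rintro ⟨t, ht, ht0, rfl⟩
    refine ⟨by omega, fun c hc => ?_⟩
    have := ht c hc
    omega
  · rintro ⟨hx, h⟩
    refine ⟨x + 1 - frob S, fun c hc => ?_, by omega, by omega⟩
    have := h c hc
    omega

theorem isNumericalSet_osum_dual {S : Set ℕ} (hS : IsNumericalSet S) (hSp : S ≠ Set.univ) :
    IsNumericalSet (osum S (dual S)) := by
  refine ⟨(mem_osum_dual hS hSp).2 (Or.inl ⟨hS.1, frob_pos hS hSp⟩),
    (Set.finite_Iio (2 * frob S)).subset fun x hx => ?_⟩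
  by_contra hlt
  rw [Set.mem_Iio, not_lt] at hlt
  exact hx ((mem_osum_dual hS hSp).2 (Or.inr ⟨by omega, fun c _ => by omega⟩))

theorem osum_dual_semigroup_iff (S : Set ℕ)
    (hS : IsNumericalSemigroup S) (hSp : S ≠ Set.univ) :
    IsNumericalSemigroup (osum S (dual S)) ↔
      (∀ a ∈ S, ∀ b ∈ S, ∀ c ∈ S, a < condNum S → b < condNum S → c < condNum S →
        2 * (frob S : ℤ) - (a : ℤ) - (b : ℤ) - 1 ≠ (c : ℤ)) := by
  have hmem := fun x => mem_osum_dual hS.1 hSp (x := x)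
  have hF := frob_notMem hS.1 hSp
  have hlt : ∀ x ∈ S, x < condNum S → x < frob S := fun x hx hxC =>
    lt_of_le_of_ne (Nat.le_of_lt_succ hxC) fun h => hF (h ▸ hx)
  constructor
  · rintro ⟨-, hadd⟩ a ha b hb c hc haC hbC hcC heq
    have haF := hlt a ha haC
    have hbF := hlt b hb hbC
    have hcF := hlt c hc hcC
    rcases (hmem _).1 (hadd a ((hmem a).2 (Or.inl ⟨ha, haF⟩)) b ((hmem b).2 (Or.inl ⟨hb, hbF⟩)))
      with ⟨-, h⟩ | ⟨-, h⟩
    · omega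
    · exact h c hc (by omega)
  · intro h
    refine ⟨isNumericalSet_osum_dual hS.1 hSp, fun x hx y hy => ?_⟩
    rw [hmem] at hx hy ⊢
    rcases hx with ⟨hx, hxF⟩ | ⟨hxF, hx⟩ <;> rcases hy with ⟨hy, hyF⟩ | ⟨hyF, hy⟩
    · rcases lt_or_ge (x + y) (frob S) with hxy | hxy
      · exact Or.inl ⟨hS.2 x hx y hy, hxy⟩
      · refine Or.inr ⟨hxy, fun c hc heq => ?_⟩
        refine h x hx y hy c hc ?_ ?_ ?_ (by omega) <;> unfold condNum <;> omega
    · exact Or.inr ⟨by omega, fun c hc heq => hy (x + c) (hS.2 x hx c hc) (by omega)⟩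
    · exact Or.inr ⟨by omega, fun c hc heq => hx (y + c) (hS.2 y hy c hc) (by omega)⟩
    · exact Or.inr ⟨by omega, fun c _ => by omega⟩
end
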